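/- Let f : ℝ^d → ℝ be C^∞, let γ < ν be positive integers, and define F_x(y) ∈ span{X^k : |k| < γ} with coefficients ∂^k f_x(y)/k! where f_x is the order-ν Taylor remainder of f at x. With Γ_{zy} the polynomial translation group (Γ_{zy} X^k = (X + (z−y))^k), one has the exact identity F_x(z) − Γ_{zy} F_x(y) = ∑_{|k|<γ} (X^k/k!) ∑_{|ℓ|=γ−|k|} ((z−y)^ℓ/ℓ!) ∫_0^1 |ℓ| (1−t)^{|ℓ|−1} ∂^{k+ℓ} f_x(y + t(z−y)) dt, and consequently the coefficient of X^k in F_x(z) − Γ_{zy} F_x(y) is bounded by C ‖z − y‖^{γ−|k|} locally uniformly. -/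

import Mathlib

open MeasureTheory

/-- Partial derivative in the `i`-th coordinate direction. -/
noncomputable def coordDeriv {d : ℕ} (i : Fin d)
    (f : EuclideanSpace ℝ (Fin d) → ℝ) : EuclideanSpace ℝ (Fin d) → ℝ :=
  fun x => fderiv ℝ f x (EuclideanSpace.single i 1)

/-- Iterated partial derivatives along a list of coordinate directions. -/
noncomputable def listDeriv {d : ℕ} :
    List (Fin d) → (EuclideanSpace ℝ (Fin d) → ℝ) → EuclideanSpace ℝ (Fin d) → ℝ
  | [], f => f
  | i :: L, f => coordDeriv i (listDeriv L f)

/-- The multiindex partial derivative `∂^k`. -/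
noncomputable def mderiv {d : ℕ} (k : Fin d → ℕ)
    (f : EuclideanSpace ℝ (Fin d) → ℝ) : EuclideanSpace ℝ (Fin d) → ℝ :=
  listDeriv ((List.finRange d).flatMap fun i => List.replicate (k i) i) f

/-- The finite set of multiindices `ℓ ∈ ℕ^d` with `|ℓ| < ν`. -/
def midxBelow (d ν : ℕ) : Finset (Fin d → ℕ) :=
  (Fintype.piFinset fun _ : Fin d => Finset.range ν).filter fun k => ∑ i, k i < ν

/-- The order-`ν` Taylor remainder `f_x(y) = f(y) - ∑_{|ℓ|<ν} ∂^ℓ f(x) (y-x)^ℓ/ℓ!`. -/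
noncomputable def taylorRem (d ν : ℕ) (f : EuclideanSpace ℝ (Fin d) → ℝ)
    (x y : EuclideanSpace ℝ (Fin d)) : ℝ :=
  f y - ∑ ℓ ∈ midxBelow d ν,
    mderiv ℓ f x * (∏ i, (y i - x i) ^ ℓ i) / ∏ i, ((ℓ i).factorial : ℝ)


/-- Coefficient of `X^k` in `F_x(z) - Γ_{zy} F_x(y)` for the polynomial model,
where `F_x(y) = ∑_{|k|<γ} ∂^k f_x(y) X^k/k!` and
`Γ_{zy} X^ℓ = ∑_{m ≤ ℓ} binom(ℓ,m) (z-y)^{ℓ-m} X^m`. -/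
noncomputable def coeffDiff (d γ ν : ℕ) (f : EuclideanSpace ℝ (Fin d) → ℝ)
    (x : EuclideanSpace ℝ (Fin d)) (k : Fin d → ℕ)
    (y z : EuclideanSpace ℝ (Fin d)) : ℝ :=
  mderiv k (taylorRem d ν f x) z / (∏ i, ((k i).factorial : ℝ))
    - ∑ ℓ ∈ (midxBelow d γ).filter (fun ℓ => ∀ i, k i ≤ ℓ i),
        (mderiv ℓ (taylorRem d ν f x) y / ∏ i, ((ℓ i).factorial : ℝ)) *
          ((∏ i, ((ℓ i).choose (k i) : ℝ)) * ∏ i, (z i - y i) ^ (ℓ i - k i))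

section MultiIndex

variable {d : ℕ}

lemma sum_midxBelow_succ (n : ℕ) (F : (Fin d → ℕ) → ℝ) :
    ∑ m ∈ midxBelow d (n + 1), F m =
      ∑ m ∈ midxBelow d n, F m + ∑ m ∈ Finset.piAntidiag Finset.univ n, F m := by
  rw [← Finset.sum_union]
  · congr 1
    ext m
    have hle : ∀ i, m i ≤ ∑ j, m j := fun i =>
      Finset.single_le_sum (fun _ _ => Nat.zero_le _) (Finset.mem_univ i)
    simp only [midxBelow, Finset.mem_filter, Fintype.mem_piFinset, Finset.mem_range,
      Finset.mem_union, Finset.mem_piAntidiag, Finset.mem_univ, implies_true, and_true]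
    constructor
    · rintro ⟨-, h⟩
      rcases Nat.lt_succ_iff_lt_or_eq.mp h with h | h
      · exact Or.inl ⟨fun i => (hle i).trans_lt h, h⟩
      · exact Or.inr h
    · rintro (⟨-, h⟩ | h)
      · exact ⟨fun i => (hle i).trans_lt (h.trans n.lt_succ_self), h.trans n.lt_succ_self⟩
      · exact ⟨fun i => (hle i).trans_lt (h ▸ n.lt_succ_self), h ▸ n.lt_succ_self⟩
  · rw [Finset.disjoint_left]
    intro m h1 h2
    simp only [midxBelow, Finset.mem_filter, Finset.mem_piAntidiag] at h1 h2
    exact absurd h2.1 h1.2.ne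

lemma monomial_div_factorial_add_single (v : Fin d → ℝ) (m : Fin d → ℕ) (i : Fin d) :
    ((m + Pi.single i 1 : Fin d → ℕ) i : ℝ) * ((∏ j, v j ^ (m + Pi.single i 1 : Fin d → ℕ) j) /
        ∏ j, (((m + Pi.single i 1 : Fin d → ℕ) j).factorial : ℝ)) =
      (∏ j, v j ^ m j) / (∏ j, ((m j).factorial : ℝ)) * v i := by
  have hpow : ∏ j, v j ^ (m + Pi.single i 1 : Fin d → ℕ) j = (∏ j, v j ^ m j) * v i := by
    simp only [Pi.add_apply, pow_add, Finset.prod_mul_distrib]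
    congr 1
    simp [Pi.single_apply, pow_ite]
  have hfac : ∏ j, (((m + Pi.single i 1 : Fin d → ℕ) j).factorial : ℝ) =
      (∏ j, ((m j).factorial : ℝ)) * (m i + 1) := by
    have : ∀ j, (((m + Pi.single i 1 : Fin d → ℕ) j).factorial : ℝ) =
        ((m j).factorial : ℝ) * if j = i then (m i + 1 : ℝ) else 1 := by
      intro j
      by_cases h : j = i
      · subst h
        simp [Nat.factorial_succ, mul_comm]
      · simp [h]
    simp_rw [this, Finset.prod_mul_distrib]
    simp
  rw [hpow, hfac]
  have h1 : (m i + 1 : ℝ) ≠ 0 := by positivity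
  have h2 : (∏ j, ((m j).factorial : ℝ)) ≠ 0 :=
    Finset.prod_ne_zero_iff.mpr fun j _ => by positivity
  simp only [Pi.add_apply, Pi.single_eq_same, Nat.cast_add, Nat.cast_one]
  field_simp

lemma sum_piAntidiag_monomial_succ (v : Fin d → ℝ) (n : ℕ) (a : (Fin d → ℕ) → ℝ) :
    ∑ m ∈ Finset.piAntidiag Finset.univ n, (∏ j, v j ^ m j) / (∏ j, ((m j).factorial : ℝ)) *
        ∑ i, v i * a (m + Pi.single i 1) =
      (n + 1) * ∑ m ∈ Finset.piAntidiag Finset.univ (n + 1),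
        (∏ j, v j ^ m j) / (∏ j, ((m j).factorial : ℝ)) * a m := by
  have hR : (n + 1 : ℝ) * ∑ m ∈ Finset.piAntidiag Finset.univ (n + 1),
        (∏ j, v j ^ m j) / (∏ j, ((m j).factorial : ℝ)) * a m =
      ∑ i, ∑ m ∈ Finset.piAntidiag Finset.univ (n + 1),
        (m i : ℝ) * ((∏ j, v j ^ m j) / (∏ j, ((m j).factorial : ℝ))) * a m := by
    rw [Finset.sum_comm, Finset.mul_sum]
    refine Finset.sum_congr rfl fun m hm => ?_
    have hsum : ∑ i, (m i : ℝ) = n + 1 := by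
      exact_mod_cast (Finset.mem_piAntidiag.mp hm).1
    rw [← Finset.sum_mul, ← Finset.sum_mul, hsum, mul_assoc]
  rw [hR]
  simp_rw [Finset.mul_sum]
  rw [Finset.sum_comm]
  refine Finset.sum_congr rfl fun i _ => ?_
  refine Finset.sum_bij_ne_zero (fun m _ _ => m + Pi.single i 1) ?_ ?_ ?_ ?_
  · intro m hm _
    simp only [Finset.mem_piAntidiag] at hm ⊢
    simp [Finset.sum_add_distrib, hm.1]
  · intro m _ _ m' _ _ h
    exact add_right_cancel h
  · intro m hm hne
    have hmi : m i ≠ 0 := by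
      intro h
      simp [h] at hne
    have hle : Pi.single i 1 ≤ m := by
      intro j
      by_cases h : j = i
      · subst h
        simpa using Nat.one_le_iff_ne_zero.mpr hmi
      · simp [h]
    have hback : m - Pi.single i 1 + Pi.single i 1 = m := tsub_add_cancel_of_le hle
    refine ⟨m - Pi.single i 1, ?_, ?_, hback⟩
    · simp only [Finset.mem_piAntidiag] at hm ⊢
      refine ⟨?_, by simp⟩
      have := hm.1
      rw [← hback] at this
      simpa [Finset.sum_add_distrib] using this
    · rw [← mul_assoc, ← monomial_div_factorial_add_single, hback]
      exact hne
  · intro m _ _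
    rw [← mul_assoc, ← monomial_div_factorial_add_single]

lemma prod_choose_div_factorial_add (k m : Fin d → ℕ) :
    (∏ i, ((k i + m i).choose (k i) : ℝ)) / (∏ i, ((k i + m i).factorial : ℝ)) =
      1 / ((∏ i, ((k i).factorial : ℝ)) * ∏ i, ((m i).factorial : ℝ)) := by
  rw [← Finset.prod_div_distrib, ← Finset.prod_mul_distrib, one_div, ← Finset.prod_inv_distrib]
  refine Finset.prod_congr rfl fun i _ => ?_
  rw [Nat.cast_add_choose]
  have h1 : ((k i).factorial : ℝ) ≠ 0 := by positivity
  have h2 : ((m i).factorial : ℝ) ≠ 0 := by positivity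
  have h3 : ((k i + m i).factorial : ℝ) ≠ 0 := by positivity
  field_simp

lemma sum_midxBelow_filter_le (γ : ℕ) (k : Fin d → ℕ) (hk : ∑ i, k i < γ)
    (F : (Fin d → ℕ) → ℝ) :
    ∑ l ∈ (midxBelow d γ).filter (fun l => ∀ i, k i ≤ l i), F l =
      ∑ m ∈ midxBelow d (γ - ∑ i, k i), F (k + m) := by
  have mem (n : ℕ) (m : Fin d → ℕ) : m ∈ midxBelow d n ↔ ∑ i, m i < n := by
    simp only [midxBelow, Finset.mem_filter, Fintype.mem_piFinset, Finset.mem_range,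
      and_iff_right_iff_imp]
    exact fun h i =>
      (Finset.single_le_sum (fun _ _ => Nat.zero_le _) (Finset.mem_univ i)).trans_lt h
  symm
  refine Finset.sum_bij (fun m _ => k + m) ?_ ?_ ?_ fun _ _ => rfl
  · intro m hm
    rw [mem] at hm
    simp only [Finset.mem_filter, mem, Pi.add_apply, Finset.sum_add_distrib]
    exact ⟨by omega, fun i => by omega⟩
  · intro m _ m' _ h
    exact add_left_cancel h
  · intro l hl
    simp only [Finset.mem_filter, mem] at hl
    have hback : k + (l - k) = l := add_tsub_cancel_of_le hl.2
    refine ⟨l - k, ?_, hback⟩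
    rw [mem]
    have := hl.1
    rw [← hback] at this
    simp only [Pi.add_apply, Finset.sum_add_distrib] at this
    omega

lemma filter_piFinset_range_eq_piAntidiag {n N : ℕ} (h : n < N) :
    (Fintype.piFinset fun _ : Fin d => Finset.range N).filter (fun l => ∑ i, l i = n) =
      Finset.piAntidiag Finset.univ n := by
  ext m
  simp only [Finset.mem_filter, Fintype.mem_piFinset, Finset.mem_range, Finset.mem_piAntidiag,
    Finset.mem_univ, implies_true, and_true, and_iff_right_iff_imp]
  rintro rfl i
  exact (Finset.single_le_sum (fun _ _ => Nat.zero_le _) (Finset.mem_univ i)).trans_lt h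

end MultiIndex

section PartialDerivatives

variable {d : ℕ} {g : EuclideanSpace ℝ (Fin d) → ℝ}

lemma ContDiff.coordDeriv (hg : ContDiff ℝ (⊤ : ℕ∞) g) (i : Fin d) :
    ContDiff ℝ (⊤ : ℕ∞) (coordDeriv i g) :=
  (hg.fderiv_right (m := (⊤ : ℕ∞)) (by simp)).clm_apply contDiff_const

lemma ContDiff.listDeriv (hg : ContDiff ℝ (⊤ : ℕ∞) g) (L : List (Fin d)) :
    ContDiff ℝ (⊤ : ℕ∞) (listDeriv L g) := by
  induction L with
  | nil => exact hg
  | cons i L ih => exact ih.coordDeriv i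

lemma coordDeriv_comm (hg : ContDiff ℝ (⊤ : ℕ∞) g) (i j : Fin d) :
    coordDeriv i (coordDeriv j g) = coordDeriv j (coordDeriv i g) := by
  have hd : Differentiable ℝ (fderiv ℝ g) :=
    (hg.fderiv_right (m := (⊤ : ℕ∞)) (by simp)).differentiable (by simp)
  have key (i j : Fin d) (x : EuclideanSpace ℝ (Fin d)) : coordDeriv i (coordDeriv j g) x =
      fderiv ℝ (fderiv ℝ g) x (EuclideanSpace.single i 1) (EuclideanSpace.single j 1) := by
    unfold coordDeriv
    rw [fderiv_clm_apply (hd x) (differentiableAt_const _)]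
    simp
  funext x
  rw [key, key]
  exact (hg.contDiffAt.isSymmSndFDerivAt (by
    rw [minSmoothness_of_isRCLikeNormedField]
    exact WithTop.coe_le_coe.mpr le_top)).eq _ _

lemma listDeriv_perm (hg : ContDiff ℝ (⊤ : ℕ∞) g) {L L' : List (Fin d)} (h : L.Perm L') :
    listDeriv L g = listDeriv L' g := by
  induction h with
  | nil => rfl
  | cons i _ ih => simp only [listDeriv, ih]
  | swap i j L => exact coordDeriv_comm (hg.listDeriv L) j i
  | trans _ _ ih ih' => exact ih.trans ih'

lemma coordDeriv_mderiv (hg : ContDiff ℝ (⊤ : ℕ∞) g) (i : Fin d) (m : Fin d → ℕ) :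
    coordDeriv i (mderiv m g) = mderiv (m + Pi.single i 1) g := by
  refine listDeriv_perm (L := i :: _) hg ?_
  rw [List.perm_iff_count]
  intro j
  have hcount (m : Fin d → ℕ) :
      ((List.finRange d).flatMap fun i => List.replicate (m i) i).count j = m j := by
    rw [List.count_flatMap, ← Fin.sum_univ_def]
    simp [List.count_replicate]
  rw [List.count_cons, hcount, hcount]
  by_cases h : i = j
  · simp [h]
  · simp [h]

lemma hasDerivAt_comp_segment (hg : ContDiff ℝ (⊤ : ℕ∞) g)
    (y v : EuclideanSpace ℝ (Fin d)) (t : ℝ) :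
    HasDerivAt (fun t : ℝ => g (y + t • v)) (∑ i, v i * coordDeriv i g (y + t • v)) t := by
  have h1 : HasDerivAt (fun t : ℝ => y + t • v) v t := by
    simpa using ((hasDerivAt_id t).smul_const v).const_add y
  have h2 := ((hg.differentiable (by simp)) (y + t • v)).hasFDerivAt.comp_hasDerivAt t h1
  have hv : v = ∑ i, v i • EuclideanSpace.single i (1 : ℝ) := by
    ext j
    simp [Pi.single_apply]
  have hfderiv : fderiv ℝ g (y + t • v) v = ∑ i, v i * coordDeriv i g (y + t • v) := by
    refine (congrArg (fderiv ℝ g (y + t • v)) hv).trans ?_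
    simp [coordDeriv]
  rwa [hfderiv] at h2

/-- Multivariate Taylor formula with integral remainder, for a family `a` of functions
indexed by multiindices that behaves like the partial derivatives of `a 0`. -/
theorem sub_taylorSum_eq_sum_integral (a : (Fin d → ℕ) → EuclideanSpace ℝ (Fin d) → ℝ)
    (ha : ∀ m, ContDiff ℝ (⊤ : ℕ∞) (a m))
    (hda : ∀ i m, coordDeriv i (a m) = a (m + Pi.single i 1))
    (y v : EuclideanSpace ℝ (Fin d)) (n : ℕ) :
    a 0 (y + v) - ∑ m ∈ midxBelow d (n + 1),
        (∏ i, v i ^ m i) / (∏ i, ((m i).factorial : ℝ)) * a m y =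
      ∑ m ∈ Finset.piAntidiag Finset.univ (n + 1),
        (∏ i, v i ^ m i) / (∏ i, ((m i).factorial : ℝ)) *
          ∫ t in (0 : ℝ)..1, ((n + 1 : ℕ) : ℝ) * (1 - t) ^ n * a m (y + t • v) := by
  have hcont (m) : Continuous fun t : ℝ => a m (y + t • v) :=
    (ha m).continuous.comp (by fun_prop)
  have hderiv (m) (t : ℝ) : HasDerivAt (fun t : ℝ => a m (y + t • v))
      (∑ i, v i * a (m + Pi.single i 1) (y + t • v)) t := by
    simpa only [hda] using hasDerivAt_comp_segment (ha m) y v t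
  have hcont' (m) : Continuous fun t : ℝ => ∑ i, v i * a (m + Pi.single i 1) (y + t • v) :=
    continuous_finsetSum _ fun i _ => continuous_const.mul
      (hcont (m + (Pi.single i 1 : Fin d → ℕ)))
  have hrem (n : ℕ) : ∑ m ∈ Finset.piAntidiag Finset.univ (n + 1),
        (∏ i, v i ^ m i) / (∏ i, ((m i).factorial : ℝ)) *
          ∫ t in (0 : ℝ)..1, ((n + 1 : ℕ) : ℝ) * (1 - t) ^ n * a m (y + t • v) =
      ∑ m ∈ Finset.piAntidiag Finset.univ n,
        (∏ i, v i ^ m i) / (∏ i, ((m i).factorial : ℝ)) *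
          ∫ t in (0 : ℝ)..1, (1 - t) ^ n * ∑ i, v i * a (m + Pi.single i 1) (y + t • v) := by
    have hint (m : Fin d → ℕ) : ∫ t in (0 : ℝ)..1, (1 - t) ^ n *
          ∑ i, v i * a (m + Pi.single i 1) (y + t • v) =
        ∑ i, v i * ∫ t in (0 : ℝ)..1, (1 - t) ^ n * a (m + Pi.single i 1) (y + t • v) := by
      simp_rw [Finset.mul_sum, ← intervalIntegral.integral_const_mul]
      rw [intervalIntegral.integral_finsetSum]
      · refine Finset.sum_congr rfl fun i _ => ?_
        congr 1
        ext t
        ring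
      · intro i _
        have := hcont (m + Pi.single i 1)
        exact Continuous.intervalIntegrable (by fun_prop) _ _
    simp_rw [hint]
    rw [sum_piAntidiag_monomial_succ v n
      fun m => ∫ t in (0 : ℝ)..1, (1 - t) ^ n * a m (y + t • v), Finset.mul_sum]
    refine Finset.sum_congr rfl fun m _ => ?_
    simp_rw [mul_assoc, intervalIntegral.integral_const_mul]
    push_cast
    ring
  induction n with
  | zero =>
    rw [hrem, sum_midxBelow_succ]
    have h0 := intervalIntegral.integral_eq_sub_of_hasDerivAt (a := 0) (b := 1)
      (fun t _ => hderiv 0 t) ((hcont' 0).intervalIntegrable _ _)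
    simp only [zero_add, one_smul, zero_smul, add_zero] at h0
    simp [midxBelow, h0]
  | succ n ih =>
    rw [hrem, sum_midxBelow_succ, ← sub_sub, ih, ← Finset.sum_sub_distrib]
    refine Finset.sum_congr rfl fun m _ => ?_
    rw [← mul_sub]
    congr 1
    have hu (t : ℝ) : HasDerivAt (fun t : ℝ => -(1 - t) ^ (n + 1))
        (((n + 1 : ℕ) : ℝ) * (1 - t) ^ n) t :=
      (((hasDerivAt_id t).const_sub 1).pow (n + 1)).neg.congr_deriv (by simp)
    have hparts := intervalIntegral.integral_mul_deriv_eq_deriv_mul (a := 0) (b := 1)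
      (fun t _ => hu t) (fun t _ => hderiv m t)
      (Continuous.intervalIntegrable (by fun_prop) _ _) ((hcont' m).intervalIntegrable _ _)
    simp [neg_mul, intervalIntegral.integral_neg] at hparts
    push_cast
    linarith

lemma contDiff_taylorRem (hf : ContDiff ℝ (⊤ : ℕ∞) g) (ν : ℕ) (x : EuclideanSpace ℝ (Fin d)) :
    ContDiff ℝ (⊤ : ℕ∞) (taylorRem d ν g x) := by
  unfold taylorRem
  refine hf.sub (ContDiff.sum fun l _ => ?_)
  refine (contDiff_const.mul (contDiff_prod fun i _ => ?_)).div_const _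
  fun_prop

end PartialDerivatives

/-- Exact Taylor identity for `F_x(z) - Γ_{zy} F_x(y)` in the polynomial
regularity structure, and the resulting local bound `C ‖z - y‖^{γ-|k|}` on the
coefficient of `X^k`. -/
theorem stmt7 {d : ℕ} (f : EuclideanSpace ℝ (Fin d) → ℝ) (hf : ContDiff ℝ (⊤ : ℕ∞) f)
    (γ ν : ℕ) (h0 : 0 < γ) (hγν : γ < ν) (x : EuclideanSpace ℝ (Fin d))
    (k : Fin d → ℕ) (hk : ∑ i, k i < γ) :
    (∀ y z : EuclideanSpace ℝ (Fin d),
      coeffDiff d γ ν f x k y z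
        = (1 / ∏ i, ((k i).factorial : ℝ)) *
          ∑ ℓ ∈ (Fintype.piFinset fun _ : Fin d => Finset.range (γ+1)).filter
              (fun ℓ => ∑ i, ℓ i = γ - ∑ i, k i),
            ((∏ i, (z i - y i) ^ ℓ i) / ∏ i, ((ℓ i).factorial : ℝ)) *
              ∫ t in (0:ℝ)..1,
                ((γ - ∑ i, k i : ℕ) : ℝ) * (1 - t) ^ ((γ - ∑ i, k i) - 1) *
                  mderiv (fun i => k i + ℓ i) (taylorRem d ν f x) (y + t • (z - y))) ∧
    (∀ K : Set (EuclideanSpace ℝ (Fin d)), IsCompact K →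
      ∃ C > (0:ℝ), ∀ y ∈ K, ∀ z ∈ K,
        |coeffDiff d γ ν f x k y z| ≤ C * ‖z - y‖ ^ (γ - ∑ i, k i)) := by
  set g := taylorRem d ν f x
  have hg : ContDiff ℝ (⊤ : ℕ∞) g := contDiff_taylorRem hf ν x
  obtain ⟨n, hn⟩ : ∃ n, γ - ∑ i, k i = n + 1 := ⟨γ - ∑ i, k i - 1, by omega⟩
  have hsmooth (m : Fin d → ℕ) : ContDiff ℝ (⊤ : ℕ∞) (mderiv (k + m) g) := hg.listDeriv _
  have hidx := filter_piFinset_range_eq_piAntidiag (d := d) (n := n + 1) (N := γ + 1) (by omega)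
  have hid : ∀ y z : EuclideanSpace ℝ (Fin d), coeffDiff d γ ν f x k y z =
      (1 / ∏ i, ((k i).factorial : ℝ)) * ∑ l ∈ Finset.piAntidiag Finset.univ (n + 1),
        ((∏ i, (z i - y i) ^ l i) / ∏ i, ((l i).factorial : ℝ)) *
          ∫ t in (0 : ℝ)..1, ((n + 1 : ℕ) : ℝ) * (1 - t) ^ n *
            mderiv (k + l) g (y + t • (z - y)) := by
    intro y z
    have htaylor := sub_taylorSum_eq_sum_integral (fun m => mderiv (k + m) g) hsmooth
      (fun i m => by rw [coordDeriv_mderiv hg, add_assoc]) y (z - y) n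
    simp only [PiLp.sub_apply, add_zero, add_sub_cancel] at htaylor
    rw [← htaylor, coeffDiff, sum_midxBelow_filter_le γ k hk, hn, mul_sub, Finset.mul_sum]
    congr 1
    · ring
    · refine Finset.sum_congr rfl fun m _ => ?_
      simp only [Pi.add_apply, add_tsub_cancel_left]
      have := prod_choose_div_factorial_add k m
      calc _ = (∏ i, ((k i + m i).choose (k i) : ℝ)) / (∏ i, ((k i + m i).factorial : ℝ)) *
            (mderiv (k + m) g y * ∏ i, (z i - y i) ^ m i) := by ring
        _ = _ := by rw [this, one_div_mul_eq_div, one_div]; field_simp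
  refine ⟨fun y z => ?_, fun K hK => ?_⟩
  · rw [hn, hidx, hid]
    rfl
  · obtain ⟨R, hR⟩ := hK.isBounded.subset_closedBall (0 : EuclideanSpace ℝ (Fin d))
    have hbound (m : Fin d → ℕ) : ∃ M, ∀ w ∈ Metric.closedBall (0 : EuclideanSpace ℝ (Fin d)) R,
        ‖mderiv (k + m) g w‖ ≤ M :=
      (isCompact_closedBall _ _).exists_bound_of_continuousOn (hsmooth m).continuous.continuousOn
    choose M hM using hbound
    set S := Finset.piAntidiag (Finset.univ : Finset (Fin d)) (n + 1)
    have hkpos : 0 < 1 / ∏ i, ((k i).factorial : ℝ) := by positivity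
    refine ⟨(1 / ∏ i, ((k i).factorial : ℝ)) *
      (∑ l ∈ S, 1 / (∏ i, ((l i).factorial : ℝ)) * (((n + 1 : ℕ) : ℝ) * |M l|)) + 1,
      by positivity, fun y hy z hz => ?_⟩
    rw [hid, hn, abs_mul, abs_of_pos hkpos]
    have hsum : |∑ l ∈ S, ((∏ i, (z i - y i) ^ l i) / ∏ i, ((l i).factorial : ℝ)) *
          ∫ t in (0 : ℝ)..1, ((n + 1 : ℕ) : ℝ) * (1 - t) ^ n *
            mderiv (k + l) g (y + t • (z - y))| ≤
        (∑ l ∈ S, 1 / (∏ i, ((l i).factorial : ℝ)) * (((n + 1 : ℕ) : ℝ) * |M l|)) *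
          ‖z - y‖ ^ (n + 1) := by
      rw [Finset.sum_mul]
      refine (Finset.abs_sum_le_sum_abs _ _).trans (Finset.sum_le_sum fun l hl => ?_)
      have hmono : |∏ i, (z i - y i) ^ l i| ≤ ‖z - y‖ ^ (n + 1) := by
        rw [← (Finset.mem_piAntidiag.mp hl).1, ← Finset.prod_pow_eq_pow_sum, Finset.abs_prod]
        refine Finset.prod_le_prod (fun _ _ => abs_nonneg _) fun i _ => ?_
        rw [abs_pow]
        exact pow_le_pow_left₀ (abs_nonneg _) (PiLp.norm_apply_le (z - y) i) _
      have hint : |∫ t in (0 : ℝ)..1, ((n + 1 : ℕ) : ℝ) * (1 - t) ^ n *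
          mderiv (k + l) g (y + t • (z - y))| ≤ ((n + 1 : ℕ) : ℝ) * |M l| := by
        have := intervalIntegral.norm_integral_le_of_norm_le_const (a := (0 : ℝ)) (b := 1)
          (C := ((n + 1 : ℕ) : ℝ) * |M l|) (f := fun t => ((n + 1 : ℕ) : ℝ) * (1 - t) ^ n *
            mderiv (k + l) g (y + t • (z - y))) fun t ht => ?_
        · simpa using this
        rw [Set.uIoc_of_le zero_le_one] at ht
        have hmem : y + t • (z - y) ∈ Metric.closedBall (0 : EuclideanSpace ℝ (Fin d)) R :=
          (convex_closedBall _ _).add_smul_sub_mem (hR hy) (hR hz) ⟨ht.1.le, ht.2⟩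
        have hpow : ‖(1 - t) ^ n‖ ≤ 1 := by
          rw [norm_pow, Real.norm_eq_abs, abs_of_nonneg (sub_nonneg.mpr ht.2)]
          exact pow_le_one₀ (sub_nonneg.mpr ht.2) (by linarith [ht.1])
        rw [mul_assoc, norm_mul, norm_mul, Real.norm_natCast]
        refine mul_le_mul_of_nonneg_left ?_ (Nat.cast_nonneg _)
        calc _ ≤ 1 * |M l| := by
              gcongr
              exact (hM l _ hmem).trans (le_abs_self _)
          _ = |M l| := one_mul _
      have hlpos : 0 < ∏ i, ((l i).factorial : ℝ) := by positivity
      rw [abs_mul, abs_div, abs_of_pos hlpos]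
      calc _ ≤ ‖z - y‖ ^ (n + 1) / (∏ i, ((l i).factorial : ℝ)) *
            (((n + 1 : ℕ) : ℝ) * |M l|) := by gcongr
        _ = _ := by ring
    calc _ ≤ (1 / ∏ i, ((k i).factorial : ℝ)) * _ := mul_le_mul_of_nonneg_left hsum hkpos.le
      _ ≤ _ := by
        rw [← mul_assoc]
        gcongr
        linarith
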